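/- For all integers i, j ≥ 0 and all t ≥ 1 one has Q_i(t) Q_j(t) ≤ h(t) Q_{i+j}(t) ≤ 2 Q_{i+j+1}(t). (Inequality (3.80) of Lemma 3.8.) -/

import Mathlib

open MeasureTheory

/-- `h(t) = ∫₁^∞ max(t, t₁)⁻¹ h₀′(t₁) dt₁`. -/
noncomputable def hFun (h₀' : ℝ → ℝ) (t : ℝ) : ℝ :=
  ∫ t₁ in Set.Ici (1 : ℝ), (max t t₁)⁻¹ * h₀' t₁

/-- `Q_m(t) = ∫₁^∞ max(t, t₁)⁻¹ h₀′(t₁) h(t₁)^m dt₁`. -/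
noncomputable def QFun (h₀' : ℝ → ℝ) (m : ℕ) (t : ℝ) : ℝ :=
  ∫ t₁ in Set.Ici (1 : ℝ), (max t t₁)⁻¹ * h₀' t₁ * hFun h₀' t₁ ^ m

/-- The kernel `max(t, s)⁻¹ h₀′(s)` is integrable in `s`. -/
lemma integrableOn_inv_max_mul {w : ℝ → ℝ} (hcont : ContinuousOn w (Set.Ici 1))
    (hint : IntegrableOn (fun t => t⁻¹ * w t) (Set.Ici 1)) (t : ℝ) :
    IntegrableOn (fun s => (max t s)⁻¹ * w s) (Set.Ici 1) := by
  refine Integrable.mono hint ?_ ?_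
  · refine (ContinuousOn.mul (ContinuousOn.inv₀ (by fun_prop) ?_) hcont).aestronglyMeasurable
      measurableSet_Ici
    intro s hs
    have : (1 : ℝ) ≤ s := hs
    have := le_max_right t s
    linarith
  · filter_upwards [ae_restrict_mem measurableSet_Ici] with s hs
    have hs1 : (1 : ℝ) ≤ s := hs
    have hm : s ≤ max t s := le_max_right t s
    rw [norm_mul, norm_mul, Real.norm_of_nonneg (by positivity : 0 ≤ (max t s)⁻¹),
      Real.norm_of_nonneg (by positivity : 0 ≤ s⁻¹)]
    gcongr

lemma hFun_nonneg {w : ℝ → ℝ} (hw : ∀ t ∈ Set.Ici (1 : ℝ), 0 ≤ w t) (t : ℝ) :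
    0 ≤ hFun w t := by
  refine setIntegral_nonneg measurableSet_Ici fun s hs => ?_
  have hs1 : (1 : ℝ) ≤ s := hs
  have hm : s ≤ max t s := le_max_right t s
  exact mul_nonneg (inv_nonneg.2 (by linarith)) (hw s hs)

lemma antitone_hFun {w : ℝ → ℝ} (hcont : ContinuousOn w (Set.Ici 1))
    (hw : ∀ t ∈ Set.Ici (1 : ℝ), 0 ≤ w t)
    (hint : IntegrableOn (fun t => t⁻¹ * w t) (Set.Ici 1)) : Antitone (hFun w) := by
  intro a b hab
  refine setIntegral_mono_on (integrableOn_inv_max_mul hcont hint b)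
    (integrableOn_inv_max_mul hcont hint a) measurableSet_Ici fun s hs => ?_
  have hs1 : (1 : ℝ) ≤ s := hs
  have hm : s ≤ max a s := le_max_right a s
  have := hw s hs
  have : 0 < max a s := by linarith
  gcongr

/-- The integrand of `QFun` is integrable. -/
lemma integrableOn_inv_max_mul_hFun_pow {w : ℝ → ℝ} (hcont : ContinuousOn w (Set.Ici 1))
    (hw : ∀ t ∈ Set.Ici (1 : ℝ), 0 ≤ w t)
    (hint : IntegrableOn (fun t => t⁻¹ * w t) (Set.Ici 1)) (m : ℕ) (t : ℝ) :
    IntegrableOn (fun s => (max t s)⁻¹ * w s * hFun w s ^ m) (Set.Ici 1) := by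
  have hanti := antitone_hFun hcont hw hint
  refine Integrable.mul_bdd (c := hFun w 1 ^ m) (integrableOn_inv_max_mul hcont hint t)
    (hanti.measurable.pow_const m).aestronglyMeasurable ?_
  filter_upwards [ae_restrict_mem measurableSet_Ici] with s hs
  have h0 := hFun_nonneg hw s
  rw [Real.norm_of_nonneg (pow_nonneg h0 m)]
  exact pow_le_pow_left₀ h0 (hanti hs) m

/-- Chebyshev's inequality for the comonotone functions `h ^ i` and `h ^ j`. -/
lemma QFun_mul_QFun_le {w : ℝ → ℝ} (hcont : ContinuousOn w (Set.Ici 1))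
    (hw : ∀ t ∈ Set.Ici (1 : ℝ), 0 ≤ w t)
    (hint : IntegrableOn (fun t => t⁻¹ * w t) (Set.Ici 1)) (i j : ℕ) (t : ℝ) :
    QFun w i t * QFun w j t ≤ hFun w t * QFun w (i + j) t := by
  set ν := (volume : Measure ℝ).restrict (Set.Ici 1) with hν
  have hG : Integrable (fun s => (max t s)⁻¹ * w s) ν := integrableOn_inv_max_mul hcont hint t
  have hF := fun m => (integrableOn_inv_max_mul_hFun_pow hcont hw hint m t : Integrable _ ν)
  have key : ∫ p, ((max t p.1)⁻¹ * w p.1 * hFun w p.1 ^ i) *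
        ((max t p.2)⁻¹ * w p.2 * hFun w p.2 ^ j) +
        ((max t p.1)⁻¹ * w p.1 * hFun w p.1 ^ j) *
        ((max t p.2)⁻¹ * w p.2 * hFun w p.2 ^ i) ∂(ν.prod ν) ≤
      ∫ p, ((max t p.1)⁻¹ * w p.1) * ((max t p.2)⁻¹ * w p.2 * hFun w p.2 ^ (i + j)) +
        ((max t p.1)⁻¹ * w p.1 * hFun w p.1 ^ (i + j)) * ((max t p.2)⁻¹ * w p.2)
        ∂(ν.prod ν) := by
    refine integral_mono_ae (((hF i).mul_prod (hF j)).add ((hF j).mul_prod (hF i)))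
      ((hG.mul_prod (hF (i + j))).add ((hF (i + j)).mul_prod hG)) ?_
    rw [hν, Measure.prod_restrict]
    filter_upwards [ae_restrict_mem (measurableSet_Ici.prod measurableSet_Ici)]
      with p ⟨h1, h2⟩
    have hm1 : 0 ≤ (max t p.1)⁻¹ * w p.1 :=
      mul_nonneg (inv_nonneg.2 ((zero_le_one.trans h1).trans (le_max_right _ _))) (hw _ h1)
    have hm2 : 0 ≤ (max t p.2)⁻¹ * w p.2 :=
      mul_nonneg (inv_nonneg.2 ((zero_le_one.trans h2).trans (le_max_right _ _))) (hw _ h2)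
    have hx := hFun_nonneg hw p.1
    have hy := hFun_nonneg hw p.2
    have hprod : 0 ≤ (hFun w p.1 ^ i - hFun w p.2 ^ i) * (hFun w p.1 ^ j - hFun w p.2 ^ j) := by
      rcases le_total (hFun w p.1) (hFun w p.2) with h | h
      · exact mul_nonneg_of_nonpos_of_nonpos (sub_nonpos.2 (pow_le_pow_left₀ hx h i))
          (sub_nonpos.2 (pow_le_pow_left₀ hx h j))
      · exact mul_nonneg (sub_nonneg.2 (pow_le_pow_left₀ hy h i))
          (sub_nonneg.2 (pow_le_pow_left₀ hy h j))
    have := mul_nonneg (mul_nonneg hm1 hm2) hprod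
    simp only [pow_add]
    linarith
  rw [integral_add ((hF i).mul_prod (hF j)) ((hF j).mul_prod (hF i)),
    integral_add (hG.mul_prod (hF (i + j))) ((hF (i + j)).mul_prod hG)] at key
  rw [integral_prod_mul (μ := ν) (ν := ν) (fun s => (max t s)⁻¹ * w s * hFun w s ^ i)
      (fun s => (max t s)⁻¹ * w s * hFun w s ^ j),
    integral_prod_mul (μ := ν) (ν := ν) (fun s => (max t s)⁻¹ * w s * hFun w s ^ j)
      (fun s => (max t s)⁻¹ * w s * hFun w s ^ i),
    integral_prod_mul (μ := ν) (ν := ν) (fun s => (max t s)⁻¹ * w s)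
      (fun s => (max t s)⁻¹ * w s * hFun w s ^ (i + j)),
    integral_prod_mul (μ := ν) (ν := ν) (fun s => (max t s)⁻¹ * w s * hFun w s ^ (i + j))
      (fun s => (max t s)⁻¹ * w s)] at key
  change QFun w i t * QFun w j t + QFun w j t * QFun w i t ≤
    hFun w t * QFun w (i + j) t + QFun w (i + j) t * hFun w t at key
  linarith

/-- The bound of `h Q_m` by `2 Q_{m+1}`, obtained by symmetrizing a double integral. -/
lemma hFun_mul_QFun_le {w : ℝ → ℝ} (hcont : ContinuousOn w (Set.Ici 1))
    (hw : ∀ t ∈ Set.Ici (1 : ℝ), 0 ≤ w t)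
    (hint : IntegrableOn (fun t => t⁻¹ * w t) (Set.Ici 1)) (m : ℕ) {t : ℝ} (ht : 1 ≤ t) :
    hFun w t * QFun w m t ≤ 2 * QFun w (m + 1) t := by
  set ν := (volume : Measure ℝ).restrict (Set.Ici 1) with hν
  have hanti := antitone_hFun hcont hw hint
  have hG : Integrable (fun s => (max t s)⁻¹ * w s) ν := integrableOn_inv_max_mul hcont hint t
  have hI : Integrable (fun s => s⁻¹ * w s) ν := hint
  have hF : Integrable (fun s => (max t s)⁻¹ * w s * hFun w s ^ m) ν :=
    integrableOn_inv_max_mul_hFun_pow hcont hw hint m t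
  have hwm : AEStronglyMeasurable w ν := hcont.aestronglyMeasurable measurableSet_Ici
  set Φ : ℝ × ℝ → ℝ := fun p =>
    ((max t p.1)⁻¹ * w p.1 * hFun w p.1 ^ m) * ((max p.1 p.2)⁻¹ * w p.2) with hΦ
  have hΦi : Integrable Φ (ν.prod ν) := by
    refine (hF.mul_prod hI).mono ?_ ?_
    · refine hF.aestronglyMeasurable.comp_fst.mul (AEStronglyMeasurable.mul ?_ hwm.comp_snd)
      exact (measurable_fst.max measurable_snd).inv.aestronglyMeasurable
    · rw [hν, Measure.prod_restrict]
      filter_upwards [ae_restrict_mem (measurableSet_Ici.prod measurableSet_Ici)]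
        with p ⟨h1, h2⟩
      have h2' : (0 : ℝ) < p.2 := zero_lt_one.trans_le h2
      have hm : p.2 ≤ max p.1 p.2 := le_max_right _ _
      rw [hΦ, norm_mul, norm_mul _ (p.2⁻¹ * w p.2), norm_mul _ (w p.2), norm_mul p.2⁻¹,
        Real.norm_of_nonneg (inv_nonneg.2 (h2'.le.trans hm)),
        Real.norm_of_nonneg (inv_nonneg.2 h2'.le)]
      gcongr
  have hΦQ : ∫ p, Φ p ∂(ν.prod ν) = QFun w (m + 1) t := by
    rw [integral_prod _ hΦi]
    refine integral_congr_ae (Filter.Eventually.of_forall fun s => ?_)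
    simp only [hΦ]
    rw [integral_const_mul]
    change _ * hFun w s = _
    ring
  have key : ∫ p, ((max t p.1)⁻¹ * w p.1) * ((max t p.2)⁻¹ * w p.2 * hFun w p.2 ^ m) +
        ((max t p.1)⁻¹ * w p.1 * hFun w p.1 ^ m) * ((max t p.2)⁻¹ * w p.2) ∂(ν.prod ν) ≤
      ∫ p, 2 * (Φ p + Φ p.swap) ∂(ν.prod ν) := by
    refine integral_mono_ae ((hG.mul_prod hF).add (hF.mul_prod hG))
      ((hΦi.add hΦi.swap).const_mul 2) ?_
    rw [hν, Measure.prod_restrict]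
    filter_upwards [ae_restrict_mem (measurableSet_Ici.prod measurableSet_Ici)]
      with p ⟨h1, h2⟩
    obtain ⟨s, r⟩ := p
    have pointwise : ∀ x y : ℝ, 1 ≤ x → x ≤ y →
        (max t x)⁻¹ * (max t y)⁻¹ * (hFun w x ^ m + hFun w y ^ m) ≤
        2 * ((max x y)⁻¹ * ((max t x)⁻¹ * hFun w x ^ m + (max t y)⁻¹ * hFun w y ^ m)) := by
      intro x y hx hxy
      have hA : hFun w y ^ m ≤ hFun w x ^ m :=
        pow_le_pow_left₀ (hFun_nonneg hw y) (hanti hxy) m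
      have hy0 := pow_nonneg (hFun_nonneg hw y) m
      have hx0 := pow_nonneg (hFun_nonneg hw x) m
      have hyp : 0 < y := by linarith
      have hxt : 0 ≤ (max t x)⁻¹ := inv_nonneg.2 (by linarith [le_max_left t x])
      have hyt : 0 ≤ (max t y)⁻¹ := inv_nonneg.2 (by linarith [le_max_left t y])
      have hle : (max t y)⁻¹ ≤ y⁻¹ := inv_anti₀ hyp (le_max_right t y)
      rw [max_eq_right hxy]
      calc (max t x)⁻¹ * (max t y)⁻¹ * (hFun w x ^ m + hFun w y ^ m)
          ≤ (max t x)⁻¹ * y⁻¹ * (hFun w x ^ m + hFun w x ^ m) := by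
            gcongr
        _ = 2 * (y⁻¹ * ((max t x)⁻¹ * hFun w x ^ m)) := by ring
        _ ≤ _ := by
          gcongr
          exact le_add_of_nonneg_right (mul_nonneg hyt hy0)
    have sym : (max t s)⁻¹ * (max t r)⁻¹ * (hFun w s ^ m + hFun w r ^ m) ≤
        2 * ((max s r)⁻¹ * ((max t s)⁻¹ * hFun w s ^ m + (max t r)⁻¹ * hFun w r ^ m)) := by
      rcases le_total s r with h | h
      · exact pointwise s r h1 h
      · have := pointwise r s h2 h
        rw [max_comm r s] at this
        linarith
    have := mul_le_mul_of_nonneg_left sym (mul_nonneg (hw s h1) (hw r h2))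
    simp only [hΦ, Prod.swap, max_comm r s]
    linarith
  rw [integral_add (hG.mul_prod hF) (hF.mul_prod hG), integral_const_mul,
    integral_add (g := fun p : ℝ × ℝ => Φ p.swap) hΦi hΦi.swap, integral_prod_swap Φ, hΦQ,
    integral_prod_mul (μ := ν) (ν := ν) (fun s => (max t s)⁻¹ * w s)
      (fun s => (max t s)⁻¹ * w s * hFun w s ^ m),
    integral_prod_mul (μ := ν) (ν := ν) (fun s => (max t s)⁻¹ * w s * hFun w s ^ m)
      (fun s => (max t s)⁻¹ * w s)] at key
  change hFun w t * QFun w m t + QFun w m t * hFun w t ≤ _ at key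
  linarith

/-- Inequality (3.80) of Lemma 3.8: for integers `i, j ≥ 0` and `t ≥ 1`,
`Q_i(t) Q_j(t) ≤ h(t) Q_{i+j}(t) ≤ 2 Q_{i+j+1}(t)`. -/
theorem stmt14 (h₀ h₀' : ℝ → ℝ)
    (hderiv : ∀ t ∈ Set.Ici (1 : ℝ), HasDerivWithinAt h₀ (h₀' t) (Set.Ici 1) t)
    (hcont : ContinuousOn h₀' (Set.Ici 1))
    (h₀nonneg : ∀ t ∈ Set.Ici (1 : ℝ), 0 ≤ h₀ t)
    (h₀'nonneg : ∀ t ∈ Set.Ici (1 : ℝ), 0 ≤ h₀' t)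
    (hint₀ : IntegrableOn (fun t => (t ^ 2)⁻¹ * h₀ t) (Set.Ici 1))
    (hint' : IntegrableOn (fun t => t⁻¹ * h₀' t) (Set.Ici 1))
    (i j : ℕ) (t : ℝ) (ht : 1 ≤ t) :
    QFun h₀' i t * QFun h₀' j t ≤ hFun h₀' t * QFun h₀' (i + j) t ∧
    hFun h₀' t * QFun h₀' (i + j) t ≤ 2 * QFun h₀' (i + j + 1) t := by
  exact ⟨QFun_mul_QFun_le hcont h₀'nonneg hint' i j t,
    hFun_mul_QFun_le hcont h₀'nonneg hint' (i + j) ht⟩
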